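/- arXiv:0812.0444 — 2 statements merged into one kernel-verified Lean document; each statement's English description precedes it below -/
import Mathlib

section
/- Let ⋆ be a semistar operation on an integral domain D. If D is ⋆̃-universally catenarian, then D is a ⋆̃-stably strong S-domain. -/
/- ## Preliminaries: general ideal-chain notions in a commutative ring -/

open Pointwise

section ChainNotions

variable {A B : Type*} [CommRing A] [CommRing B]

/-- `P` and `Q` are adjacent with respect to the class `Φ` of ideals:
`P ⊂ Q` and no ideal of the class `Φ` lies strictly between them. -/
def AdjacentFor (Φ : Ideal A → Prop) (P Q : Ideal A) : Prop :=
  P < Q ∧ ∀ I : Ideal A, Φ I → ¬(P < I ∧ I < Q)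

/-- A saturated chain, consisting of ideals of the class `Φ`, of length `m`
between `P` and `Q` (saturated: consecutive members are `Φ`-adjacent). -/
def SaturatedChainFor (Φ : Ideal A → Prop) (P Q : Ideal A) (m : ℕ) : Prop :=
  ∃ c : Fin (m + 1) → Ideal A, StrictMono c ∧ c 0 = P ∧ c (Fin.last m) = Q ∧
    (∀ i, Φ (c i)) ∧ ∀ i : Fin m, AdjacentFor Φ (c i.castSucc) (c i.succ)

/-- Catenarity with respect to the class `Φ` of ideals: for every pair `P ⊂ Q` of
`Φ`-ideals, any two saturated chains of `Φ`-ideals between `P` and `Q` have the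
same (finite) length. -/
def CatenaryFor (Φ : Ideal A → Prop) : Prop :=
  ∀ P Q : Ideal A, Φ P → Φ Q → P < Q →
    ∀ m₁ m₂ : ℕ, SaturatedChainFor Φ P Q m₁ → SaturatedChainFor Φ P Q m₂ → m₁ = m₂

/-- A chain `(0) = P₀ ⊂ P₁ ⊂ ⋯ ⊂ Pₙ` with all `Pᵢ`, `1 ≤ i ≤ n`, in the class `Φ`. -/
def DimChainFor (Φ : Ideal A → Prop) (n : ℕ) : Prop :=
  ∃ c : Fin (n + 1) → Ideal A, StrictMono c ∧ c 0 = ⊥ ∧ ∀ i, i ≠ 0 → Φ (c i)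

/-- The dimension associated to the class `Φ` of (quasi-prime) ideals: the supremum of
the lengths of chains `(0) = P₀ ⊂ P₁ ⊂ ⋯ ⊂ Pₙ` with all `Pᵢ` (`i ≥ 1`) in `Φ`. -/
noncomputable def quasiDim (Φ : Ideal A → Prop) : ℕ∞ :=
  ⨆ (n : ℕ) (_ : DimChainFor Φ n), (n : ℕ∞)

/-- The height of an ideal `P`: the supremum of lengths of strict chains of prime
ideals ending at `P`. -/
noncomputable def idealHeight (P : Ideal A) : ℕ∞ :=
  ⨆ (n : ℕ) (_ : ∃ c : Fin (n + 1) → Ideal A, StrictMono c ∧ (∀ i, (c i).IsPrime) ∧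
      c (Fin.last n) = P), (n : ℕ∞)

/-- The Krull dimension of a commutative ring, as the supremum in `ℕ∞` of the lengths
of strict chains of prime ideals. -/
noncomputable def krullDimE (A : Type*) [CommRing A] : ℕ∞ :=
  ⨆ (n : ℕ) (_ : ∃ c : Fin (n + 1) → Ideal A, StrictMono c ∧ ∀ i, (c i).IsPrime), (n : ℕ∞)

/-- Every pair of `Φ`-adjacent `Φ`-ideals `P ⊂ Q` of `A` extends, along `f : A →+* B`,
to a pair of `Ψ`-adjacent `Ψ`-ideals `P.map f ⊂ Q.map f` of `B`. -/
def ExtendsAdjacent (f : A →+* B) (Φ : Ideal A → Prop) (Ψ : Ideal B → Prop) : Prop :=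
  ∀ P Q : Ideal A, Φ P → Φ Q → AdjacentFor Φ P Q →
    Ψ (Ideal.map f P) ∧ Ψ (Ideal.map f Q) ∧ AdjacentFor Ψ (Ideal.map f P) (Ideal.map f Q)

/-- A (classically) catenary ring: any two saturated chains of primes between a fixed
pair of primes `P ⊂ Q` have the same finite length. -/
def IsCatenaryRing (A : Type*) [CommRing A] : Prop :=
  CatenaryFor (fun I : Ideal A => I.IsPrime)

/-- A (classical) S-domain: every height-one prime `P` extends to a height-one prime
`P[X]` of the polynomial ring. -/
def IsSDomain (A : Type*) [CommRing A] : Prop :=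
  ∀ P : Ideal A, P.IsPrime → idealHeight P = 1 →
    idealHeight (Ideal.map (Polynomial.C : A →+* Polynomial A) P) = 1

/-- A (classical) strong S-domain: every pair of adjacent primes `P ⊂ Q` extends to a
pair of adjacent primes `P[X] ⊂ Q[X]` of the polynomial ring. -/
def IsStrongSDomain (A : Type*) [CommRing A] : Prop :=
  ExtendsAdjacent (Polynomial.C : A →+* Polynomial A)
    (fun I : Ideal A => I.IsPrime) (fun I : Ideal (Polynomial A) => I.IsPrime)

/-- A (classical) stably strong S-domain: `A[X₁,…,Xₙ]` is a strong S-domain for all `n ≥ 1`. -/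
def IsStablyStrongSDomain (A : Type*) [CommRing A] : Prop :=
  ∀ n : ℕ, 1 ≤ n → IsStrongSDomain (MvPolynomial (Fin n) A)

/-- A (classical) Jaffard domain: finite Krull dimension, and
`dim (A[X₁,…,Xₙ]) = dim A + n` for all `n ≥ 1`. -/
def IsJaffardDomain (A : Type*) [CommRing A] : Prop :=
  krullDimE A ≠ ⊤ ∧ ∀ n : ℕ, 1 ≤ n → krullDimE (MvPolynomial (Fin n) A) = krullDimE A + n

end ChainNotions

/- ## Semistar operations -/

section Semistar

variable (R : Type*) (F : Type*) [CommRing R] [Field F] [Algebra R F]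

instance (priority := 100) : SMulCommClass F R F := SMulCommClass.symm R F F

/-- A semistar operation on a domain `R` with quotient field `F`: an operation on the
(nonzero) `R`-submodules of `F` satisfying `(xE)^⋆ = x E^⋆`, monotonicity, extensivity
and idempotency. (The value on the zero submodule is irrelevant.) -/
structure SemistarOp where
  /-- the underlying map on `R`-submodules of `F` -/
  star : Submodule R F → Submodule R F
  star_smul : ∀ x : F, x ≠ 0 → ∀ E : Submodule R F, E ≠ ⊥ → star (x • E) = x • star E
  star_mono : ∀ E G : Submodule R F, E ≠ ⊥ → G ≠ ⊥ → E ≤ G → star E ≤ star G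
  le_star : ∀ E : Submodule R F, E ≠ ⊥ → E ≤ star E
  star_idem : ∀ E : Submodule R F, E ≠ ⊥ → star (star E) = star E

variable {R F}

/-- The extension of an ideal of `R` to an `R`-submodule of `F`. -/
def idealExt (I : Ideal R) : Submodule R F := Submodule.map (Algebra.linearMap R F) I

/-- The contraction to `R` of an `R`-submodule of `F` (i.e. `E ∩ R`). -/
def idealCon (E : Submodule R F) : Ideal R := Submodule.comap (Algebra.linearMap R F) E

/-- The finite-type semistar operation `⋆_f` associated to `⋆`:
`E^{⋆_f}` is the union of `G^⋆` over all nonzero finitely generated `G ⊆ E`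
(the family is directed, so the union is the supremum). -/
noncomputable def SemistarOp.ft (s : SemistarOp R F) (E : Submodule R F) : Submodule R F :=
  ⨆ (G : Submodule R F) (_ : G.FG ∧ G ≠ ⊥ ∧ G ≤ E), s.star G

/-- `I` is a quasi-`f`-ideal (for `f` a semistar-type operation, e.g. `s.star`, `s.ft`
or `s.tilde`): `I` is nonzero and `f(I) ∩ R = I`. -/
def IsQuasiIdeal (f : Submodule R F → Submodule R F) (I : Ideal R) : Prop :=
  I ≠ ⊥ ∧ idealCon (f (idealExt I)) = I

/-- A quasi-prime: a prime quasi-ideal. -/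
def IsQuasiPrime (f : Submodule R F → Submodule R F) (I : Ideal R) : Prop :=
  I.IsPrime ∧ IsQuasiIdeal f I

/-- A quasi-maximal ideal: maximal among proper quasi-ideals. -/
def IsQuasiMax (f : Submodule R F → Submodule R F) (I : Ideal R) : Prop :=
  IsQuasiIdeal f I ∧ I ≠ ⊤ ∧ ∀ J : Ideal R, IsQuasiIdeal f J → J ≠ ⊤ → I ≤ J → I = J

/-- The stable finite-type semistar operation `⋆̃` associated to `⋆`:
`E^{⋆̃} = ⋂ { E R_P : P a quasi-⋆_f-maximal ideal }`, where
`x ∈ E R_P ↔ ∃ d ∉ P, d • x ∈ E` (each quasi-⋆_f-maximal ideal is prime); if there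
is no quasi-⋆_f-maximal ideal, `E^{⋆̃} = F`. -/
def SemistarOp.tilde (s : SemistarOp R F) (E : Submodule R F) : Submodule R F where
  carrier := {x : F | ∀ P : Ideal R, IsQuasiMax s.ft P → P.IsPrime →
    ∃ d : R, d ∉ P ∧ d • x ∈ E}
  zero_mem' := by
    intro P _ hP
    exact ⟨1, fun h => hP.ne_top ((Ideal.eq_top_iff_one P).mpr h), by simp⟩
  add_mem' := by
    intro x y hx hy P hPmax hP
    obtain ⟨d₁, hd₁, hdx⟩ := hx P hPmax hP
    obtain ⟨d₂, hd₂, hdy⟩ := hy P hPmax hP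
    refine ⟨d₁ * d₂, fun h => (hP.mem_or_mem h).elim hd₁ hd₂, ?_⟩
    have h₁ : (d₁ * d₂) • x ∈ E := by rw [mul_comm, mul_smul]; exact E.smul_mem d₂ hdx
    have h₂ : (d₁ * d₂) • y ∈ E := by rw [mul_smul]; exact E.smul_mem d₁ hdy
    simpa [smul_add] using E.add_mem h₁ h₂
  smul_mem' := by
    intro r x hx P hPmax hP
    obtain ⟨d, hd, hdx⟩ := hx P hPmax hP
    refine ⟨d, hd, ?_⟩
    rw [smul_smul, mul_comm, ← smul_smul]
    exact E.smul_mem r hdx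

/-- The characterization of the quasi-`⋆[n]`-prime ideals of `R[n] = R[X₁,…,Xₙ]` for the
iterated Nagata-type (stable, finite-type) semistar operation `⋆[n]` on `R[n]`:
a nonzero prime `Q` of `R[n]` is quasi-`⋆[n]`-prime iff `Q ∩ R = 0` or
`(Q ∩ R)^{⋆_f} ≠ R^⋆`. -/
def QuasiPolyPrime (s : SemistarOp R F) (n : ℕ) (Q : Ideal (MvPolynomial (Fin n) R)) : Prop :=
  Q ≠ ⊥ ∧ Q.IsPrime ∧
    (Ideal.comap (algebraMap R (MvPolynomial (Fin n) R)) Q = ⊥ ∨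
      s.ft (idealExt (Ideal.comap (algebraMap R (MvPolynomial (Fin n) R)) Q)) ≠
        s.star (idealExt (⊤ : Ideal R)))

/-- The `⋆̃`-dimension of `R`. -/
noncomputable def tildeDim (s : SemistarOp R F) : ℕ∞ := quasiDim (IsQuasiPrime s.tilde)

/-- The `⋆[n]`-dimension of `R[n] = R[X₁,…,Xₙ]`. -/
noncomputable def polyDim (s : SemistarOp R F) (n : ℕ) : ℕ∞ := quasiDim (QuasiPolyPrime s n)

/-- `R` is a `⋆̃`-S-domain: every height-one quasi-`⋆̃`-prime `P` extends to a height-one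
quasi-`⋆[1]`-prime `P[X₁]` of `R[X₁]`. -/
def TildeSDomain (s : SemistarOp R F) : Prop :=
  ∀ P : Ideal R, IsQuasiPrime s.tilde P → idealHeight P = 1 →
    QuasiPolyPrime s 1 (Ideal.map (algebraMap R (MvPolynomial (Fin 1) R)) P) ∧
    idealHeight (Ideal.map (algebraMap R (MvPolynomial (Fin 1) R)) P) = 1

/-- `R` is a `⋆̃`-strong S-domain: each pair of adjacent quasi-`⋆̃`-primes `P₁ ⊂ P₂`
extends to a pair of adjacent quasi-`⋆[1]`-primes `P₁[X₁] ⊂ P₂[X₁]` of `R[X₁]`. -/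
def TildeStrongSDomain (s : SemistarOp R F) : Prop :=
  ExtendsAdjacent (algebraMap R (MvPolynomial (Fin 1) R))
    (IsQuasiPrime s.tilde) (QuasiPolyPrime s 1)

/-- `R[n]` is a `⋆[n]`-strong S-domain: each pair of adjacent quasi-`⋆[n]`-primes
`Q₁ ⊂ Q₂` of `R[n]` extends to a pair of adjacent quasi-`⋆[n+1]`-primes
`Q₁[X_{n+1}] ⊂ Q₂[X_{n+1}]` of `R[n+1]`. -/
def PolyStrongSDomain (s : SemistarOp R F) (n : ℕ) : Prop :=
  ExtendsAdjacent (MvPolynomial.rename (Fin.castSucc : Fin n → Fin (n + 1))).toRingHom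
    (QuasiPolyPrime s n) (QuasiPolyPrime s (n + 1))

/-- `R` is a `⋆̃`-stably strong S-domain: `R[n]` is a `⋆[n]`-strong S-domain for all
`n ≥ 1`. -/
def TildeStablyStrongSDomain (s : SemistarOp R F) : Prop :=
  ∀ n : ℕ, 1 ≤ n → PolyStrongSDomain s n

/-- `R` is `⋆̃`-catenary. -/
def TildeCatenary (s : SemistarOp R F) : Prop := CatenaryFor (IsQuasiPrime s.tilde)

/-- `R[n]` is `⋆[n]`-catenary. -/
def PolyCatenary (s : SemistarOp R F) (n : ℕ) : Prop := CatenaryFor (QuasiPolyPrime s n)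

/-- `R` is `⋆̃`-universally catenarian: `R[n]` is `⋆[n]`-catenary for all `n ≥ 1`. -/
def TildeUnivCatenarian (s : SemistarOp R F) : Prop :=
  ∀ n : ℕ, 1 ≤ n → PolyCatenary s n

/-- `R` is a `⋆̃`-Jaffard domain. -/
def TildeJaffard (s : SemistarOp R F) : Prop :=
  tildeDim s ≠ ⊤ ∧ ∀ n : ℕ, 1 ≤ n → polyDim s n = tildeDim s + n

/-- `R` is `⋆̃`-Noetherian: ascending chain condition on quasi-`⋆̃`-ideals. -/
def TildeNoetherian (s : SemistarOp R F) : Prop :=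
  ∀ f : ℕ → Ideal R, (∀ i, IsQuasiIdeal s.tilde (f i)) → Monotone f →
    ∃ N : ℕ, ∀ m : ℕ, N ≤ m → f m = f N

/-- `R` is a `⋆̃`-quasi-Prüfer domain: every prime `Q` of `R[X]` with `Q ⊆ P[X]` for some
quasi-`⋆̃`-prime `P` of `R` satisfies `Q = (Q ∩ R)[X]`. -/
def TildeQuasiPrufer (s : SemistarOp R F) : Prop :=
  ∀ Q : Ideal (Polynomial R), Q.IsPrime →
    (∃ P : Ideal R, IsQuasiPrime s.tilde P ∧
      Q ≤ Ideal.map (Polynomial.C : R →+* Polynomial R) P) →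
    Q = Ideal.map (Polynomial.C : R →+* Polynomial R)
      (Ideal.comap (Polynomial.C : R →+* Polynomial R) Q)

/-- `R` is a Prüfer `⋆`-multiplication domain: `(I · (R :_F I))^{⋆_f} = R^⋆` for every
nonzero finitely generated ideal `I` of `R`. -/
def IsPStarMD (s : SemistarOp R F) : Prop :=
  ∀ I : Ideal R, I ≠ ⊥ → I.FG →
    s.ft (idealExt I * ((idealExt (⊤ : Ideal R) : Submodule R F) / idealExt I)) =
      s.star (idealExt (⊤ : Ideal R))

/-- An overring `T` of `R` (with semistar operation `⋆'`) is `(⋆,⋆')`-linked to `R`: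
for every nonzero finitely generated ideal `G` of `R`, `G^⋆ = R^⋆` implies
`(GT)^{⋆'} = T^{⋆'}`. -/
def IsLinkedOverring (s : SemistarOp R F) (T : Subalgebra R F) (s' : SemistarOp T F) : Prop :=
  ∀ G : Ideal R, G ≠ ⊥ → G.FG →
    s.star (idealExt G) = s.star (idealExt (⊤ : Ideal R)) →
      s'.star (idealExt (Ideal.map (algebraMap R T) G)) =
        s'.star (idealExt (⊤ : Ideal T))

/-- `R` is a `⋆̃`-going-down domain: for every overring `T` of `R` (a subring of `F`
containing `R`; note `F` is also the quotient field of `T`) and every semistar operation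
`⋆'` on `T`, the extension `R ⊆ T` satisfies `(⋆̃,⋆̃')`-GD. -/
def TildeGoingDown (s : SemistarOp R F) : Prop :=
  ∀ (T : Subalgebra R F) (s' : SemistarOp T F),
    ∀ P₀ P : Ideal R, IsQuasiPrime s.tilde P₀ → IsQuasiPrime s.tilde P → P₀ < P →
      ∀ Q : Ideal T, IsQuasiPrime s'.tilde Q → Ideal.comap (algebraMap R T) Q = P →
        ∃ Q₀ : Ideal T, IsQuasiPrime s'.tilde Q₀ ∧ Q₀ ≤ Q ∧
          Ideal.comap (algebraMap R T) Q₀ = P₀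

end Semistar
section Helpers

open Polynomial in
/-- Three distinct comparable primes of `A[X]` cannot all lie over the same prime of `A`. -/
theorem Polynomial.not_lt_of_lt_of_comap_C_eq {A : Type*} [CommRing A] {p₁ p₂ p₃ : Ideal A[X]}
    (h₁ : p₁.IsPrime) (h₂ : p₂.IsPrime) (h₃ : p₃.IsPrime) (h₁₂ : p₁ < p₂)
    (e₁₂ : p₁.comap C = p₂.comap C) (e₂₃ : p₂.comap C = p₃.comap C) : ¬ p₂ < p₃ := by
  intro h₂₃
  let p : PrimeSpectrum A := PrimeSpectrum.comap C ⟨p₂, h₂⟩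
  have hdim : Order.krullDim (PrimeSpectrum.comap (C : A →+* A[X]) ⁻¹' {p}) ≤ 1 := by
    rw [show C = (algebraMap A A[X]) from rfl, Order.krullDim_eq_of_orderIso
      (PrimeSpectrum.preimageOrderIsoFiber A A[X] p), ← ringKrullDim,
      ← ringKrullDim_eq_of_ringEquiv (polyEquivTensor A (p.asIdeal.ResidueField)).toRingEquiv]
    exact (Ring.krullDimLE_iff (n := 1)).mp inferInstance
  let q₁ : PrimeSpectrum.comap (C : A →+* A[X]) ⁻¹' {p} := ⟨⟨p₁, h₁⟩, PrimeSpectrum.ext e₁₂⟩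
  let q₂ : PrimeSpectrum.comap (C : A →+* A[X]) ⁻¹' {p} := ⟨⟨p₂, h₂⟩, rfl⟩
  let q₃ : PrimeSpectrum.comap (C : A →+* A[X]) ⁻¹' {p} := ⟨⟨p₃, h₃⟩, PrimeSpectrum.ext e₂₃.symm⟩
  have l₁₂ : q₁ < q₂ := h₁₂
  have l₂₃ : q₂ < q₃ := h₂₃
  let c : LTSeries (PrimeSpectrum.comap (C : A →+* A[X]) ⁻¹' {p}) :=
    { length := 2
      toFun := ![q₁, q₂, q₃]
      step := fun i => by fin_cases i <;> assumption }
  have hc : ((2 : ℕ) : WithBot ℕ∞) ≤ (1 : ℕ) := (Order.LTSeries.length_le_krullDim c).trans hdim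
  exact absurd (Nat.cast_le.mp hc) (by decide)

variable {A B : Type*} [CommRing A] [CommRing B]

theorem SaturatedChainFor.of_three {Φ : Ideal A → Prop} {P Q S : Ideal A}
    (hP : Φ P) (hQ : Φ Q) (hS : Φ S) (h₁ : AdjacentFor Φ P Q) (h₂ : AdjacentFor Φ Q S) :
    SaturatedChainFor Φ P S 2 := by
  refine ⟨![P, Q, S], Fin.strictMono_iff_lt_succ.mpr ?_, rfl, rfl, ?_, ?_⟩
  · intro i; fin_cases i
    exacts [h₁.1, h₂.1]
  · intro i; fin_cases i <;> assumption
  · intro i; fin_cases i <;> assumption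

theorem SaturatedChainFor.of_four {Φ : Ideal A → Prop} {P Q S T : Ideal A}
    (hP : Φ P) (hQ : Φ Q) (hS : Φ S) (hT : Φ T)
    (h₁ : AdjacentFor Φ P Q) (h₂ : AdjacentFor Φ Q S) (h₃ : AdjacentFor Φ S T) :
    SaturatedChainFor Φ P T 3 := by
  refine ⟨![P, Q, S, T], Fin.strictMono_iff_lt_succ.mpr ?_, rfl, rfl, ?_, ?_⟩
  · intro i; fin_cases i
    exacts [h₁.1, h₂.1, h₃.1]
  · intro i; fin_cases i <;> assumption
  · intro i; fin_cases i <;> assumption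

/-- Let `f : A →+* B` behave like the inclusion of `A` in `A[X]`, with retraction `g` behaving like
evaluation at `0`. If `B` is catenary with respect to a class `Ψ` of primes which over nonzero
primes is determined by the class `Φ` of contractions, then `Φ`-adjacent pairs extend to
`Ψ`-adjacent pairs. -/
theorem CatenaryFor.extendsAdjacent {Φ : Ideal A → Prop} {Ψ : Ideal B → Prop}
    (f : A →+* B) (g : B →+* A) (hgf : g.comp f = RingHom.id A)
    (hmap : ∀ P : Ideal A, P.IsPrime → (P.map f).IsPrime)
    (hker : ∀ P : Ideal A, P.IsPrime → ¬ RingHom.ker g ≤ P.map f)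
    (hfib : ∀ p₁ p₂ p₃ : Ideal B, p₁.IsPrime → p₂.IsPrime → p₃.IsPrime → p₁ < p₂ →
      p₁.comap f = p₂.comap f → p₂.comap f = p₃.comap f → ¬ p₂ < p₃)
    (hΦ : ∀ P, Φ P → P.IsPrime) (hΦbot : ∀ P, Φ P → P ≠ ⊥) (hΨ : ∀ I, Ψ I → I.IsPrime)
    (hΨΦ : ∀ I : Ideal B, I.IsPrime → I.comap f ≠ ⊥ → (Ψ I ↔ Φ (I.comap f)))
    (hcat : CatenaryFor Ψ) : ExtendsAdjacent f Φ Ψ := by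
  have hgf' (a : A) : g (f a) = a := RingHom.congr_fun hgf a
  have hg : Function.Surjective g := fun a => ⟨f a, hgf' a⟩
  have hcomap_g (P : Ideal A) : (P.comap g).comap f = P := by
    rw [Ideal.comap_comap, hgf, Ideal.comap_id]
  have hmap_le (P : Ideal A) : P.map f ≤ P.comap g :=
    Ideal.map_le_iff_le_comap.mpr (hcomap_g P).ge
  have hcomap_map (P : Ideal A) : (P.map f).comap f = P :=
    le_antisymm ((Ideal.comap_mono (hmap_le P)).trans_eq (hcomap_g P)) Ideal.le_comap_map
  have hlt (P : Ideal A) (hP : P.IsPrime) : P.map f < P.comap g :=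
    lt_of_le_not_ge (hmap_le P) fun h =>
      hker P hP ((Ideal.comap_mono bot_le : RingHom.ker g ≤ P.comap g).trans h)
  have hΨ_of (I : Ideal B) (hI : I.IsPrime) (h : Φ (I.comap f)) : Ψ I :=
    (hΨΦ I hI (hΦbot _ h)).mpr h
  have hΨmap (P : Ideal A) (h : Φ P) : Ψ (P.map f) :=
    hΨ_of _ (hmap P (hΦ P h)) ((hcomap_map P).symm ▸ h)
  have hΨcomap (P : Ideal A) (h : Φ P) : Ψ (P.comap g) :=
    have := hΦ P h
    hΨ_of _ inferInstance ((hcomap_g P).symm ▸ h)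
  -- two comparable primes over the same prime are adjacent
  have hadj_fib (I J : Ideal B) (hI : Ψ I) (hJ : Ψ J) (hIJ : I < J)
      (he : I.comap f = J.comap f) : AdjacentFor Ψ I J := by
    refine ⟨hIJ, fun K hK ⟨h₁, h₂⟩ => ?_⟩
    have e₁ : I.comap f = K.comap f := le_antisymm (Ideal.comap_mono h₁.le)
      ((Ideal.comap_mono h₂.le).trans_eq he.symm)
    exact hfib I K J (hΨ _ hI) (hΨ _ hK) (hΨ _ hJ) h₁ e₁ (e₁.symm.trans he) h₂
  intro P Q hP hQ hPQ
  have between (K : Ideal B) (hK : Ψ K) (h₁ : P ≤ K.comap f) (h₂ : K.comap f ≤ Q) :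
      K.comap f = P ∨ K.comap f = Q := by
    by_contra! hne
    have hbot : K.comap f ≠ ⊥ := fun h => hΦbot P hP (le_bot_iff.mp (h ▸ h₁))
    exact hPQ.2 _ ((hΨΦ K (hΨ K hK) hbot).mp hK)
      ⟨lt_of_le_of_ne h₁ hne.1.symm, lt_of_le_of_ne h₂ hne.2⟩
  have hPQ' : P.map f < Q.map f := by
    refine lt_of_le_of_ne (Ideal.map_mono hPQ.1.le) fun h => hPQ.1.ne ?_
    rw [← hcomap_map P, h, hcomap_map]
  have hPQg : P.comap g < Q.comap g := by
    refine lt_of_le_of_ne (Ideal.comap_mono hPQ.1.le) fun h => hPQ.1.ne ?_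
    rw [← hcomap_g P, h, hcomap_g]
  refine ⟨hΨmap P hP, hΨmap Q hQ, hPQ', fun N hN ⟨hPN, hNQ⟩ => ?_⟩
  have hle (K : Ideal B) (h : P.map f ≤ K) : P ≤ K.comap f := Ideal.map_le_iff_le_comap.mp h
  have hge (K : Ideal B) (h : K ≤ Q.comap g) : K.comap f ≤ Q :=
    (Ideal.comap_mono h).trans_eq (hcomap_g Q)
  have over_P (K : Ideal B) (hK : Ψ K) (h₁ : P.map f ≤ K) (h₂ : K < Q.map f) :
      K.comap f = P :=
    (between K hK (hle K h₁) (hge K (h₂.le.trans (hmap_le Q)))).resolve_right fun h =>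
      h₂.not_ge (Ideal.map_le_iff_le_comap.mpr h.ge)
  have hNP : N.comap f = P := over_P N hN hPN.le hNQ
  have a₁ : AdjacentFor Ψ (P.map f) N :=
    hadj_fib _ _ (hΨmap P hP) hN hPN ((hcomap_map P).trans hNP.symm)
  have a₂ : AdjacentFor Ψ N (Q.map f) := by
    refine ⟨hNQ, fun K hK ⟨h₁, h₂⟩ => ?_⟩
    have hKP := over_P K hK (hPN.le.trans h₁.le) h₂
    exact hfib _ N K (hΨ _ (hΨmap P hP)) (hΨ _ hN) (hΨ _ hK) hPN
      ((hcomap_map P).trans hNP.symm) (hNP.trans hKP.symm) h₁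
  have a₃ : AdjacentFor Ψ (Q.map f) (Q.comap g) :=
    hadj_fib _ _ (hΨmap Q hQ) (hΨcomap Q hQ) (hlt Q (hΦ Q hQ))
      ((hcomap_map Q).trans (hcomap_g Q).symm)
  have b₁ : AdjacentFor Ψ (P.map f) (P.comap g) :=
    hadj_fib _ _ (hΨmap P hP) (hΨcomap P hP) (hlt P (hΦ P hP))
      ((hcomap_map P).trans (hcomap_g P).symm)
  have b₂ : AdjacentFor Ψ (P.comap g) (Q.comap g) := by
    refine ⟨hPQg, fun K hK ⟨h₁, h₂⟩ => ?_⟩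
    have hkerK : RingHom.ker g ≤ K :=
      (Ideal.comap_mono bot_le : RingHom.ker g ≤ P.comap g).trans h₁.le
    have hKg : K = (K.comap f).comap g := by
      ext x
      have hx : x - f (g x) ∈ K := hkerK (by simp [RingHom.mem_ker, hgf'])
      rw [Ideal.mem_comap, Ideal.mem_comap]
      exact ⟨fun h => by simpa using K.sub_mem h hx, fun h => by simpa using K.add_mem hx h⟩
    rcases between K hK (hle K ((hmap_le P).trans h₁.le)) (hge K h₂.le) with h | h
    · exact h₁.ne (by rw [hKg, h])
    · exact h₂.ne (by rw [hKg, h])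
  exact absurd
    (hcat _ _ (hΨmap P hP) (hΨcomap Q hQ) (hPQ'.trans (hlt Q (hΦ Q hQ))) 3 2
      (.of_four (hΨmap P hP) hN (hΨmap Q hQ) (hΨcomap Q hQ) a₁ a₂ a₃)
      (.of_three (hΨmap P hP) (hΨcomap P hP) (hΨcomap Q hQ) b₁ b₂)) (by decide)

open Polynomial in
/-- The case of `CatenaryFor.extendsAdjacent` where `B` is isomorphic to `A[X]` over `A`. -/
theorem CatenaryFor.extendsAdjacent_of_equiv {Φ : Ideal A → Prop} {Ψ : Ideal B → Prop}
    (f : A →+* B) (e : B ≃+* A[X]) (hf : (e : B →+* A[X]).comp f = C)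
    (hΦ : ∀ P, Φ P → P.IsPrime) (hΦbot : ∀ P, Φ P → P ≠ ⊥) (hΨ : ∀ I, Ψ I → I.IsPrime)
    (hΨΦ : ∀ I : Ideal B, I.IsPrime → I.comap f ≠ ⊥ → (Ψ I ↔ Φ (I.comap f)))
    (hcat : CatenaryFor Ψ) : ExtendsAdjacent f Φ Ψ := by
  have hf' (a : A) : e (f a) = C a := RingHom.congr_fun hf a
  have hfe : f = (e.symm : A[X] →+* B).comp C := by
    ext a
    simp [← hf']
  have hmap (P : Ideal A) : P.map f = (P.map C).comap (e : B →+* A[X]) := by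
    rw [hfe, ← Ideal.map_map]
    exact Ideal.map_symm e
  refine hcat.extendsAdjacent f ((evalRingHom 0).comp (e : B →+* A[X])) ?_ ?_ ?_ ?_ hΦ hΦbot hΨ hΨΦ
  · ext a
    simp [hf']
  · intro P hP
    rw [hmap]
    infer_instance
  · intro P hP h
    have hX : e.symm X ∈ P.map f := h ((RingHom.mem_ker).mpr (by simp))
    rw [hmap, Ideal.mem_comap] at hX
    have := Ideal.mem_map_C_iff.mp hX 1
    simp only [RingEquiv.coe_toRingHom, RingEquiv.apply_symm_apply, coeff_X_one] at this
    exact hP.ne_top ((Ideal.eq_top_iff_one P).mpr this)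
  · intro p₁ p₂ p₃ h₁ h₂ h₃ h₁₂ e₁₂ e₂₃ h₂₃
    have hcomap (p : Ideal B) : (p.comap (e.symm : A[X] →+* B)).comap C = p.comap f := by
      rw [Ideal.comap_comap, hfe]
    have hlt {p q : Ideal B} (h : p < q) :
        p.comap (e.symm : A[X] →+* B) < q.comap (e.symm : A[X] →+* B) :=
      (Ideal.comap_mono h.le).lt_of_not_ge fun h' => h.not_ge
        ((Ideal.comap_le_comap_iff_of_surjective _ e.symm.surjective _ _).mp h')
    exact Polynomial.not_lt_of_lt_of_comap_C_eq (h₁.comap _) (h₂.comap _) (h₃.comap _) (hlt h₁₂)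
      (by rw [hcomap, hcomap, e₁₂]) (by rw [hcomap, hcomap, e₂₃]) (hlt h₂₃)

end Helpers

/-- Every `⋆̃`-universally catenarian domain is a `⋆̃`-stably strong
S-domain. -/
theorem tildeUnivCatenarian_isTildeStablyStrongS (D : Type*) [CommRing D] [IsDomain D]
    (s : SemistarOp D (FractionRing D)) (h : TildeUnivCatenarian s) :
    TildeStablyStrongSDomain s := by
  intro n hn
  let e : MvPolynomial (Fin (n + 1)) D ≃ₐ[D] Polynomial (MvPolynomial (Fin n) D) :=
    (MvPolynomial.renameEquiv D finSuccEquivLast).trans (MvPolynomial.optionEquivLeft D (Fin n))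
  refine (h (n + 1) (by lia)).extendsAdjacent_of_equiv _ e.toRingEquiv ?_
    (fun P hP => hP.2.1) (fun P hP => hP.1) (fun I hI => hI.2.1) fun I hI hbot => ?_
  · refine MvPolynomial.ringHom_ext (fun r => ?_) fun i => ?_ <;> simp [e]
  · have hcomap : (I.comap (MvPolynomial.rename (R := D) (Fin.castSucc : Fin n → _)).toRingHom).comap
        (algebraMap D (MvPolynomial (Fin n) D)) =
          I.comap (algebraMap D (MvPolynomial (Fin (n + 1)) D)) := by
      rw [Ideal.comap_comap]
      exact congrArg (Ideal.comap · I) (MvPolynomial.rename _).comp_algebraMap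
    have hI0 : I ≠ ⊥ := by
      rintro rfl
      exact hbot (RingHom.ker_eq_bot_iff_eq_zero _ |>.mpr fun x hx =>
        MvPolynomial.rename_injective _ (Fin.castSucc_injective n) (by simpa using hx))
    simp only [QuasiPolyPrime, hcomap]
    exact ⟨fun hQ => ⟨hbot, hI.comap _, hQ.2.2⟩, fun hQ => ⟨hI0, hI, hQ.2.2⟩⟩
end

section
/- Let ⋆ be a semistar operation on an integral domain D, let T be an overring of D (D ⊆ T ⊆ K, where K is the quotient field of D), and let ⋆' be a semistar operation on T such that T is (⋆,⋆')-linked to D. Then the contraction map Q ↦ Q ∩ D sends quasi-⋆̃'-prime ideals of T to quasi-⋆̃-prime ideals of D; that is, if Q is a quasi-⋆̃'-prime ideal of T, then Q ∩ D is a quasi-⋆̃-prime ideal of D. -/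
/- ## Preliminaries: general ideal-chain notions in a commutative ring -/

open Pointwise

section FiniteType

variable {R F : Type*} [CommRing R] [Field F] [Algebra R F]

theorem Submodule.FG.exists_le_of_le_iSup {M : Type*} [AddCommGroup M] [Module R M]
    {N : Submodule R M} (hN : N.FG) {ι : Type*} [Nonempty ι] {f : ι → Submodule R M}
    (hf : Directed (· ≤ ·) f) (h : N ≤ ⨆ i, f i) : ∃ i, N ≤ f i := by
  obtain ⟨_, ⟨i, rfl⟩, hi⟩ :=
    (CompleteLattice.isCompactElement_iff_le_of_directed_sSup_le _ N).1
      ((Submodule.fg_iff_compact N).1 hN) _ (Set.range_nonempty f) hf.directedOn_range h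
  exact ⟨i, hi⟩

theorem algebraMap_mem_idealExt_iff [FaithfulSMul R F] {I : Ideal R} {r : R} :
    algebraMap R F r ∈ (idealExt I : Submodule R F) ↔ r ∈ I := by
  constructor
  · rintro ⟨a, ha, h⟩
    exact FaithfulSMul.algebraMap_injective R F h ▸ ha
  · exact fun h => ⟨r, h, rfl⟩

theorem idealExt_ne_bot [FaithfulSMul R F] {I : Ideal R} (hI : I ≠ ⊥) :
    (idealExt I : Submodule R F) ≠ ⊥ := fun h =>
  hI (Submodule.map_injective_of_injective (f := Algebra.linearMap R F)
    (FaithfulSMul.algebraMap_injective R F) (h.trans (Submodule.map_bot _).symm))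

theorem idealExt_mono {I J : Ideal R} (h : I ≤ J) :
    (idealExt I : Submodule R F) ≤ idealExt J :=
  Submodule.map_mono h

theorem one_mem_idealExt_top : (1 : F) ∈ (idealExt (⊤ : Ideal R) : Submodule R F) :=
  ⟨1, trivial, map_one (algebraMap R F)⟩

theorem SemistarOp.star_le_star_of_le_star (s : SemistarOp R F) {E G : Submodule R F}
    (hE : E ≠ ⊥) (hG : G ≠ ⊥) (h : E ≤ s.star G) : s.star E ≤ s.star G := by
  have hG' : s.star G ≠ ⊥ := fun h0 => hG (le_bot_iff.1 (h0 ▸ s.le_star G hG))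
  simpa only [s.star_idem G hG] using s.star_mono _ _ hE hG' h

theorem SemistarOp.star_le_ft (s : SemistarOp R F) {E G : Submodule R F} (hfg : G.FG)
    (hG : G ≠ ⊥) (hGE : G ≤ E) : s.star G ≤ s.ft E :=
  le_iSup₂_of_le G ⟨hfg, hG, hGE⟩ le_rfl

/-- A finitely generated submodule of `E^{⋆_f}` is already contained in `G^⋆` for some
nonzero finitely generated `G ⊆ E`. -/
theorem SemistarOp.exists_le_star_of_le_ft (s : SemistarOp R F) {E H : Submodule R F}
    (hE : E ≠ ⊥) (hH : H.FG) (hHE : H ≤ s.ft E) :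
    ∃ G : Submodule R F, G.FG ∧ G ≠ ⊥ ∧ G ≤ E ∧ H ≤ s.star G := by
  let ι := {G : Submodule R F // G.FG ∧ G ≠ ⊥ ∧ G ≤ E}
  obtain ⟨e, he, he0⟩ := E.ne_bot_iff.1 hE
  have : Nonempty ι :=
    ⟨⟨R ∙ e, Submodule.fg_span_singleton e, by simpa using he0, by simpa using he⟩⟩
  have hdir : Directed (· ≤ ·) fun G : ι => s.star G.1 := by
    rintro ⟨G₁, hfg₁, h₁, hle₁⟩ ⟨G₂, hfg₂, h₂, hle₂⟩
    have h : G₁ ⊔ G₂ ≠ ⊥ := fun h => h₁ (sup_eq_bot_iff.1 h).1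
    exact ⟨⟨G₁ ⊔ G₂, hfg₁.sup hfg₂, h, sup_le hle₁ hle₂⟩,
      s.star_mono _ _ h₁ h le_sup_left, s.star_mono _ _ h₂ h le_sup_right⟩
  have hft : s.ft E = ⨆ G : ι, s.star G.1 := iSup_subtype' ..
  rw [hft] at hHE
  obtain ⟨⟨G, hfg, hG, hle⟩, h⟩ := hH.exists_le_of_le_iSup hdir hHE
  exact ⟨G, hfg, hG, hle, h⟩

theorem SemistarOp.mem_ft_iff (s : SemistarOp R F) {E : Submodule R F} (hE : E ≠ ⊥) {x : F} :
    x ∈ s.ft E ↔ ∃ G : Submodule R F, G.FG ∧ G ≠ ⊥ ∧ G ≤ E ∧ x ∈ s.star G := by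
  constructor
  · intro hx
    simpa using s.exists_le_star_of_le_ft hE (Submodule.fg_span_singleton (R := R) x)
      (by simpa using hx)
  · rintro ⟨G, hfg, hG, hle, hx⟩
    exact s.star_le_ft hfg hG hle hx

theorem SemistarOp.le_ft (s : SemistarOp R F) (E : Submodule R F) : E ≤ s.ft E := by
  intro x hx
  by_cases h0 : x = 0
  · simp [h0]
  · have h : (R ∙ x) ≠ ⊥ := by simpa using h0
    exact s.star_le_ft (Submodule.fg_span_singleton x) h (by simpa using hx)
      (s.le_star _ h (Submodule.mem_span_singleton_self x))

theorem SemistarOp.ft_le_ft_of_le_ft (s : SemistarOp R F) {E E' : Submodule R F}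
    (hE' : E' ≠ ⊥) (h : E ≤ s.ft E') : s.ft E ≤ s.ft E' := by
  refine iSup₂_le fun G ⟨hfg, hG, hle⟩ => ?_
  obtain ⟨G', hfg', hG', hle', hGG'⟩ := s.exists_le_star_of_le_ft hE' hfg (hle.trans h)
  exact (s.star_le_star_of_le_star hG hG' hGG').trans (s.star_le_ft hfg' hG' hle')

theorem SemistarOp.smul_mem_ft (s : SemistarOp R F) {E E' : Submodule R F} (hE : E ≠ ⊥)
    {x y : F} (hx : x ≠ 0) (hxE : x • E ≤ E') (hy : y ∈ s.ft E) : x * y ∈ s.ft E' := by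
  obtain ⟨G, hfg, hG, hle, hyG⟩ := (s.mem_ft_iff hE).1 hy
  have hxG : x • G ≠ ⊥ := by
    obtain ⟨g, hg, hg0⟩ := G.ne_bot_iff.1 hG
    exact (Submodule.ne_bot_iff _).2
      ⟨x • g, Submodule.smul_mem_pointwise_smul g x G hg, smul_ne_zero hx hg0⟩
  refine s.star_le_ft (hfg.map _) hxG (le_trans (Submodule.map_mono hle) hxE) ?_
  change x * y ∈ s.star (x • G)
  rw [s.star_smul x hx G hG]
  exact Submodule.smul_mem_pointwise_smul y x _ hyG

theorem IsQuasiIdeal.one_notMem {f : Submodule R F → Submodule R F} {I : Ideal R}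
    (h : IsQuasiIdeal f I) (hI : I ≠ ⊤) : (1 : F) ∉ f (idealExt I) := by
  intro h1
  refine hI ((Ideal.eq_top_iff_one I).2 ?_)
  rw [← h.2]
  change algebraMap R F 1 ∈ f (idealExt I)
  rwa [map_one]

/-- A nonzero ideal `I` with `1 ∉ I^{⋆_f}` is contained in a quasi-`⋆_f`-maximal ideal,
which is prime. -/
theorem SemistarOp.exists_isQuasiMax_ge [FaithfulSMul R F] (s : SemistarOp R F) {I : Ideal R}
    (hI : I ≠ ⊥) (h1 : (1 : F) ∉ s.ft (idealExt I)) :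
    ∃ N : Ideal R, IsQuasiMax s.ft N ∧ N.IsPrime ∧ I ≤ N := by
  have ne_bot {J : Ideal R} (h : I ≤ J) : J ≠ ⊥ := fun h0 => hI (le_bot_iff.1 (h0 ▸ h))
  obtain ⟨N, hIN, hN⟩ := zorn_le_nonempty₀ {J : Ideal R | I ≤ J ∧ (1 : F) ∉ s.ft (idealExt J)}
    (by
      intro c hc hchain J hJ
      refine ⟨sSup c, ⟨(hc hJ).1.trans (le_sSup hJ), fun h => ?_⟩, fun _ => le_sSup⟩
      obtain ⟨G, hfg, hG, hle, hmem⟩ :=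
        (s.mem_ft_iff (idealExt_ne_bot (ne_bot ((hc hJ).1.trans (le_sSup hJ))))).1 h
      have hext : (idealExt (sSup c) : Submodule R F) = ⨆ J : c, idealExt J.1 := by
        rw [sSup_eq_iSup']
        exact Submodule.map_iSup ..
      have : Nonempty c := ⟨⟨J, hJ⟩⟩
      have hdir : Directed (· ≤ ·) fun J : c => (idealExt J.1 : Submodule R F) := by
        intro J₁ J₂
        obtain ⟨J₃, h₁, h₂⟩ := hchain.directed J₁ J₂
        exact ⟨J₃, idealExt_mono h₁, idealExt_mono h₂⟩
      rw [hext] at hle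
      obtain ⟨J', hJ'⟩ := hfg.exists_le_of_le_iSup hdir hle
      exact (hc J'.2).2 (s.star_le_ft hfg hG hJ' hmem))
    I ⟨le_rfl, h1⟩
  have hNbot : (idealExt N : Submodule R F) ≠ ⊥ := idealExt_ne_bot (ne_bot hIN)
  have hmax {J : Ideal R} (hNJ : N ≤ J) (hJ : (1 : F) ∉ s.ft (idealExt J)) : J ≤ N :=
    hN.2 ⟨hIN.trans hNJ, hJ⟩ hNJ
  have hle : N ≤ idealCon (s.ft (idealExt N : Submodule R F)) := fun r hr =>
    s.le_ft _ (algebraMap_mem_idealExt_iff.2 hr)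
  have hquasi : IsQuasiIdeal s.ft N := by
    refine ⟨ne_bot hIN, le_antisymm (hmax hle fun h => hN.1.2 ?_) hle⟩
    exact s.ft_le_ft_of_le_ft hNbot (Submodule.map_comap_le _ _) h
  have htop : N ≠ ⊤ := fun h => hN.1.2 (h ▸ s.le_ft _ one_mem_idealExt_top)
  refine ⟨N, ⟨hquasi, htop, fun J hJ hJtop hNJ => le_antisymm hNJ
    (hmax hNJ (hJ.one_notMem hJtop))⟩, ⟨htop, ?_⟩, hIN⟩
  intro a b hab
  by_contra! h
  obtain ⟨ha, hb⟩ := h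
  have hsup : (1 : F) ∈ s.ft (idealExt (N ⊔ Ideal.span {a})) := by
    by_contra hcon
    exact ha (hmax le_sup_left hcon
      (le_sup_right (a := N) (Ideal.mem_span_singleton_self a)))
  have hb0 : algebraMap R F b ≠ 0 := by
    rw [Ne, FaithfulSMul.algebraMap_eq_zero_iff]
    exact fun h => hb (h ▸ N.zero_mem)
  refine hb ?_
  rw [← hquasi.2]
  change algebraMap R F b ∈ s.ft (idealExt N)
  rw [← mul_one (algebraMap R F b)]
  refine s.smul_mem_ft (idealExt_ne_bot (ne_bot (hIN.trans le_sup_left))) hb0 ?_ hsup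
  rintro _ ⟨_, ⟨r, hr, rfl⟩, rfl⟩
  obtain ⟨n, hn, t, ht, rfl⟩ := Submodule.mem_sup.1 hr
  obtain ⟨c, rfl⟩ := Ideal.mem_span_singleton'.1 ht
  refine ⟨b * (n + c * a), ?_, map_mul (algebraMap R F) _ _⟩
  have h : b * (n + c * a) = b * n + c * (a * b) := by ring
  rw [h]
  exact N.add_mem (N.mul_mem_left _ hn) (N.mul_mem_left _ hab)

theorem IsQuasiPrime.exists_isQuasiMax_ge [FaithfulSMul R F] {s : SemistarOp R F} {Q : Ideal R}
    (hQ : IsQuasiPrime s.tilde Q) : ∃ M : Ideal R, IsQuasiMax s.ft M ∧ M.IsPrime ∧ Q ≤ M := by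
  by_contra! hcon
  refine hQ.2.one_notMem hQ.1.ne_top fun P hP hPprime => ?_
  obtain ⟨d, hdQ, hdP⟩ := SetLike.not_le_iff_exists.1 (hcon P hP hPprime)
  refine ⟨d, hdP, ?_⟩
  rwa [← Algebra.algebraMap_eq_smul_one, algebraMap_mem_idealExt_iff]

theorem Ideal.IsPrime.isQuasiPrime_tilde [FaithfulSMul R F] {s : SemistarOp R F} {p N : Ideal R}
    (hp : p.IsPrime) (hp0 : p ≠ ⊥) (hN : IsQuasiMax s.ft N) (hNprime : N.IsPrime) (hpN : p ≤ N) :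
    IsQuasiPrime s.tilde p := by
  refine ⟨hp, hp0, le_antisymm (fun x hx => ?_) fun x hx P _ hP => ?_⟩
  · obtain ⟨d, hd, hdx⟩ := hx N hN hNprime
    rw [Algebra.linearMap_apply, Algebra.smul_def, ← map_mul, algebraMap_mem_idealExt_iff] at hdx
    exact (hp.mem_or_mem hdx).resolve_left fun h => hd (hpN h)
  · refine ⟨1, P.ne_top_iff_one.1 hP.ne_top, ?_⟩
    rw [one_smul]
    exact algebraMap_mem_idealExt_iff.2 hx

theorem IsLinkedOverring.one_notMem_ft_comap [FaithfulSMul R F] [Nontrivial R]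
    {s : SemistarOp R F} {T : Subalgebra R F}
    {s' : SemistarOp T F} (hlink : IsLinkedOverring s T s') {M : Ideal T}
    (hM : (1 : F) ∉ s'.ft (idealExt M)) (hM0 : Ideal.comap (algebraMap R T) M ≠ ⊥) :
    (1 : F) ∉ s.ft (idealExt (Ideal.comap (algebraMap R T) M)) := by
  intro h
  obtain ⟨G, hfg, hG, hle, h1⟩ := (s.mem_ft_iff (idealExt_ne_bot hM0)).1 h
  obtain ⟨G₀, hG₀le, rfl⟩ : ∃ G₀ ≤ Ideal.comap (algebraMap R T) M, idealExt G₀ = G := by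
    refine ⟨idealCon G, fun r hr => algebraMap_mem_idealExt_iff.1 (hle hr), ?_⟩
    exact Submodule.map_comap_eq_self (hle.trans LinearMap.map_le_range)
  have hG₀ : G₀ ≠ ⊥ := by
    rintro rfl
    exact hG (Submodule.map_bot _)
  have hG₀fg : G₀.FG :=
    Submodule.fg_of_fg_map_injective _ (FaithfulSMul.algebraMap_injective R F) hfg
  have htop : (idealExt (⊤ : Ideal R) : Submodule R F) ≠ ⊥ := idealExt_ne_bot top_ne_bot
  have hstar : s.star (idealExt G₀) = s.star (idealExt (⊤ : Ideal R)) := by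
    refine le_antisymm (s.star_mono _ _ hG htop (idealExt_mono le_top))
      (s.star_le_star_of_le_star htop hG ?_)
    rintro _ ⟨r, -, rfl⟩
    rw [Algebra.linearMap_apply, Algebra.algebraMap_eq_smul_one]
    exact Submodule.smul_mem _ r h1
  have hinj : Function.Injective (algebraMap R T) := fun a b h =>
    FaithfulSMul.algebraMap_injective R F (congrArg Subtype.val h)
  have hmap : Ideal.map (algebraMap R T) G₀ ≠ ⊥ := by
    rw [Ne, Ideal.map_eq_bot_iff_of_injective hinj]
    exact hG₀
  refine hM (s'.star_le_ft (Submodule.FG.map _ (Ideal.FG.map hG₀fg (algebraMap R T)))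
    (idealExt_ne_bot hmap)
    (idealExt_mono (Ideal.map_le_iff_le_comap.2 hG₀le)) ?_)
  change (1 : F) ∈ s'.star (idealExt (Ideal.map (algebraMap R T) G₀))
  rw [hlink G₀ hG₀ hG₀fg hstar]
  exact s'.le_star _ (idealExt_ne_bot top_ne_bot) one_mem_idealExt_top

theorem Subalgebra.comap_ne_bot [IsDomain R] [IsFractionRing R F] (T : Subalgebra R F)
    {Q : Ideal T} (hQ : Q ≠ ⊥) : Ideal.comap (algebraMap R T) Q ≠ ⊥ := by
  obtain ⟨q, hq, hq0⟩ := Q.ne_bot_iff.1 hQ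
  obtain ⟨a, b, hb, hab⟩ := IsFractionRing.div_surjective (A := R) (q : F)
  have hb0 : algebraMap R F b ≠ 0 := by
    simpa using nonZeroDivisors.ne_zero hb
  have ha : algebraMap R T a = algebraMap R T b * q := by
    ext
    change algebraMap R F a = algebraMap R F b * q
    rw [← hab, mul_div_cancel₀ _ hb0]
  refine (Submodule.ne_bot_iff _).2 ⟨a, ?_, ?_⟩
  · rw [Ideal.mem_comap, ha]
    exact Q.mul_mem_left _ hq
  · rintro rfl
    apply hq0
    ext
    simpa using hab.symm

end FiniteType

/-- If `T` is a `(⋆,⋆')`-linked overring of `D`, then contraction maps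
quasi-`⋆̃'`-prime ideals of `T` to quasi-`⋆̃`-prime ideals of `D`. -/
theorem linked_comap_quasiPrime (D : Type*) [CommRing D] [IsDomain D]
    (s : SemistarOp D (FractionRing D)) (T : Subalgebra D (FractionRing D))
    (s' : SemistarOp T (FractionRing D)) (hlink : IsLinkedOverring s T s') :
    ∀ Q : Ideal T, IsQuasiPrime s'.tilde Q →
      IsQuasiPrime s.tilde (Ideal.comap (algebraMap D T) Q) := by
  intro Q hQ
  obtain ⟨M, hM, hMprime, hQM⟩ := hQ.exists_isQuasiMax_ge
  have hp0 := T.comap_ne_bot hQ.2.1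
  have hM0 := T.comap_ne_bot hM.1.1
  obtain ⟨N, hN, hNprime, hMN⟩ := s.exists_isQuasiMax_ge hM0
    (hlink.one_notMem_ft_comap (hM.1.one_notMem hM.2.1) hM0)
  have := hQ.1
  exact (Ideal.comap_isPrime (algebraMap D T) Q).isQuasiPrime_tilde hp0 hN hNprime
    ((Ideal.comap_mono hQM).trans hMN)
end
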